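/- Let Φ denote the standard normal CDF, logit(p) = log p − log(1−p) for p ∈ (0,1), and let 0 < a_L < a_U and b be real constants. Define f(t) = Φ(a_U√t + b) − Φ(a_L√t + b) for t > 0. Then f(t) ∈ (0,1) for all t > 0, the function g(t) = logit(f(t)) is differentiable for sufficiently large t, and lim_{t→∞} g′(t) = −a_L²/2 = −min{a_U², a_L²}/2. (This is Theorem 1(b) of the paper in the case θ < δ_L, so the hypothesis H_{1,k} is false.) -/

import Mathlib

open Filter Real

/-- The standard normal CDF: Φ(x) = ∫_{−∞}^{x} e^{−t²/2}/√(2π) dt. -/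
noncomputable def stdNormCDF (x : ℝ) : ℝ :=
  ∫ t in Set.Iic x, Real.exp (-t ^ 2 / 2) / Real.sqrt (2 * Real.pi)

/-- logit(p) = log p − log(1−p). -/
noncomputable def logit (p : ℝ) : ℝ := Real.log p - Real.log (1 - p)

open Topology MeasureTheory ProbabilityTheory

/-- The standard normal density. -/
noncomputable def stdNormPDF (x : ℝ) : ℝ :=
  Real.exp (-x ^ 2 / 2) / Real.sqrt (2 * Real.pi)

lemma stdNormPDF_pos (x : ℝ) : 0 < stdNormPDF x := by
  unfold stdNormPDF; positivity

lemma continuous_stdNormPDF : Continuous stdNormPDF := by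
  unfold stdNormPDF; fun_prop

lemma stdNormPDF_eq_gaussianPDFReal : stdNormPDF = gaussianPDFReal 0 1 := by
  ext x
  simp [stdNormPDF, gaussianPDFReal, div_eq_inv_mul]

lemma integrable_stdNormPDF : Integrable stdNormPDF := by
  rw [stdNormPDF_eq_gaussianPDFReal]
  exact integrable_gaussianPDFReal 0 1

lemma hasDerivAt_stdNormPDF (x : ℝ) : HasDerivAt stdNormPDF (-x * stdNormPDF x) x := by
  have h : HasDerivAt (fun y : ℝ => -y ^ 2 / 2) (-x) x := by
    exact (((hasDerivAt_pow 2 x).neg).div_const 2).congr_deriv (by norm_num; ring)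
  exact (h.exp.div_const (Real.sqrt (2 * Real.pi))).congr_deriv (by unfold stdNormPDF; ring)

lemma stdNormCDF_eq_integral (x : ℝ) :
    stdNormCDF x = ∫ t in Set.Iic x, stdNormPDF t := rfl

lemma stdNormCDF_eq_cdf (x : ℝ) : stdNormCDF x = cdf (gaussianReal 0 1) x := by
  rw [cdf_eq_real, measureReal_def, gaussianReal_apply_eq_integral 0 one_ne_zero,
    ENNReal.toReal_ofReal, stdNormCDF_eq_integral, stdNormPDF_eq_gaussianPDFReal]
  exact integral_nonneg fun t => gaussianPDFReal_nonneg 0 1 t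

lemma tendsto_stdNormCDF_atTop : Tendsto stdNormCDF atTop (𝓝 1) := by
  rw [funext stdNormCDF_eq_cdf]
  exact tendsto_cdf_atTop _

lemma hasDerivAt_stdNormCDF (x : ℝ) : HasDerivAt stdNormCDF (stdNormPDF x) x := by
  have h : stdNormCDF = fun y => (∫ t in (0 : ℝ)..y, stdNormPDF t) + stdNormCDF 0 := by
    ext y
    rw [stdNormCDF_eq_integral, stdNormCDF_eq_integral,
      ← intervalIntegral.integral_Iic_sub_Iic integrable_stdNormPDF.integrableOn
        integrable_stdNormPDF.integrableOn]
    ring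
  rw [h]
  exact (intervalIntegral.integral_hasDerivAt_right
    (continuous_stdNormPDF.intervalIntegrable _ _)
    continuous_stdNormPDF.stronglyMeasurable.stronglyMeasurableAtFilter
    continuous_stdNormPDF.continuousAt).add_const _

lemma strictMono_stdNormCDF : StrictMono stdNormCDF :=
  strictMono_of_hasDerivAt_pos hasDerivAt_stdNormCDF stdNormPDF_pos

lemma stdNormCDF_pos (x : ℝ) : 0 < stdNormCDF x := by
  refine lt_of_le_of_lt ?_ (strictMono_stdNormCDF (sub_one_lt x))
  rw [stdNormCDF_eq_cdf]
  exact cdf_nonneg _ _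

lemma stdNormCDF_lt_one (x : ℝ) : stdNormCDF x < 1 := by
  refine lt_of_lt_of_le (strictMono_stdNormCDF (lt_add_one x)) ?_
  rw [stdNormCDF_eq_cdf]
  exact cdf_le_one _ _

lemma stdNormCDF_sub_mem_Ioo {x y : ℝ} (h : x < y) :
    stdNormCDF y - stdNormCDF x ∈ Set.Ioo (0 : ℝ) 1 :=
  ⟨sub_pos.2 (strictMono_stdNormCDF h), by linarith [stdNormCDF_pos x, stdNormCDF_lt_one y]⟩

lemma hasDerivAt_logit {p : ℝ} (hp : p ∈ Set.Ioo (0 : ℝ) 1) :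
    HasDerivAt logit (1 / (p * (1 - p))) p := by
  have h0 : p ≠ 0 := hp.1.ne'
  have h1 : 1 - p ≠ 0 := (sub_pos.2 hp.2).ne'
  refine ((Real.hasDerivAt_log h0).sub (((hasDerivAt_id p).const_sub 1).log h1)).congr_deriv ?_
  simp only [id]
  field_simp
  ring

lemma tendsto_mul_add_atTop {a : ℝ} (ha : 0 < a) (b : ℝ) :
    Tendsto (fun s : ℝ => a * s + b) atTop atTop :=
  tendsto_atTop_add_const_right _ _ (tendsto_id.const_mul_atTop ha)

lemma tendsto_stdNormPDF_atTop : Tendsto stdNormPDF atTop (𝓝 0) := by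
  have h : Tendsto (fun x : ℝ => -x ^ 2 / 2) atTop atBot := by
    have := (tendsto_pow_atTop (α := ℝ) two_ne_zero).const_mul_atTop_of_neg
      (show (-1 / 2 : ℝ) < 0 by norm_num)
    exact this.congr fun x => by ring
  rw [← zero_div (Real.sqrt (2 * Real.pi))]
  exact (Real.tendsto_exp_atBot.comp h).div_const _

lemma tendsto_stdNormPDF_div_stdNormPDF {aL aU : ℝ} (haL : 0 < aL) (haLU : aL < aU) (b : ℝ) :
    Tendsto (fun s : ℝ => stdNormPDF (aU * s + b) / stdNormPDF (aL * s + b)) atTop (𝓝 0) := by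
  have h : Tendsto (fun s : ℝ => -((aU - aL) / 2) * (s * ((aU + aL) * s + 2 * b)))
      atTop atBot :=
    (tendsto_id.atTop_mul_atTop₀ (tendsto_mul_add_atTop (by linarith) (2 * b)))
      |>.const_mul_atTop_of_neg (by linarith)
  refine (Real.tendsto_exp_atBot.comp h).congr fun s => ?_
  have hpi : Real.sqrt (2 * Real.pi) ≠ 0 := by positivity
  simp only [stdNormPDF, Function.comp]
  rw [div_div_div_cancel_right₀ hpi, ← Real.exp_sub]
  congr 1
  ring

lemma hasDerivAt_mul_add (a b s : ℝ) : HasDerivAt (fun s : ℝ => a * s + b) a s :=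
  (((hasDerivAt_id s).const_mul a).add_const b).congr_deriv (mul_one a)

/-- The standard normal probability of the interval `(aL * s + b, aU * s + b)`. -/
noncomputable def stdNormInterval (aL aU b s : ℝ) : ℝ :=
  stdNormCDF (aU * s + b) - stdNormCDF (aL * s + b)

/-- The derivative of `stdNormInterval` in `s`. -/
noncomputable def stdNormIntervalDeriv (aL aU b s : ℝ) : ℝ :=
  aU * stdNormPDF (aU * s + b) - aL * stdNormPDF (aL * s + b)

lemma hasDerivAt_stdNormInterval (aL aU b s : ℝ) :
    HasDerivAt (stdNormInterval aL aU b) (stdNormIntervalDeriv aL aU b s) s :=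
  (((hasDerivAt_stdNormCDF _).comp s (hasDerivAt_mul_add aU b s)).sub
    ((hasDerivAt_stdNormCDF _).comp s (hasDerivAt_mul_add aL b s))).congr_deriv
    (by unfold stdNormIntervalDeriv; ring)

lemma hasDerivAt_stdNormIntervalDeriv (aL aU b s : ℝ) :
    HasDerivAt (stdNormIntervalDeriv aL aU b)
      (aL ^ 2 * (aL * s + b) * stdNormPDF (aL * s + b) -
        aU ^ 2 * (aU * s + b) * stdNormPDF (aU * s + b)) s :=
  ((((hasDerivAt_stdNormPDF _).comp s (hasDerivAt_mul_add aU b s)).const_mul aU).sub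
    (((hasDerivAt_stdNormPDF _).comp s (hasDerivAt_mul_add aL b s)).const_mul aL)).congr_deriv
    (by ring)

lemma tendsto_stdNormInterval {aL aU : ℝ} (haL : 0 < aL) (haU : 0 < aU) (b : ℝ) :
    Tendsto (stdNormInterval aL aU b) atTop (𝓝 0) := by
  rw [← sub_self (1 : ℝ)]
  exact (tendsto_stdNormCDF_atTop.comp (tendsto_mul_add_atTop haU b)).sub
    (tendsto_stdNormCDF_atTop.comp (tendsto_mul_add_atTop haL b))

lemma tendsto_stdNormIntervalDeriv {aL aU : ℝ} (haL : 0 < aL) (haU : 0 < aU) (b : ℝ) :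
    Tendsto (stdNormIntervalDeriv aL aU b) atTop (𝓝 0) := by
  have h := ((tendsto_stdNormPDF_atTop.comp (tendsto_mul_add_atTop haU b)).const_mul aU).sub
    ((tendsto_stdNormPDF_atTop.comp (tendsto_mul_add_atTop haL b)).const_mul aL)
  rwa [mul_zero, mul_zero, sub_zero] at h

lemma tendsto_stdNormIntervalDeriv_div {aL aU : ℝ} (haL : 0 < aL) (haLU : aL < aU) (b : ℝ) :
    Tendsto (fun s => stdNormIntervalDeriv aL aU b s / s / stdNormInterval aL aU b s)
      atTop (𝓝 (-aL ^ 2)) := by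
  have haU : 0 < aU := haL.trans haLU
  have hr := tendsto_stdNormPDF_div_stdNormPDF haL haLU b
  have hmul : ∀ s, stdNormPDF (aL * s + b) *
      (stdNormPDF (aU * s + b) / stdNormPDF (aL * s + b)) = stdNormPDF (aU * s + b) := fun s => by
    rw [mul_div_assoc', mul_div_cancel_left₀ _ (stdNormPDF_pos _).ne']
  have hfac : ∀ s, stdNormIntervalDeriv aL aU b s = stdNormPDF (aL * s + b) *
      (aU * (stdNormPDF (aU * s + b) / stdNormPDF (aL * s + b)) - aL) := by
    intro s
    unfold stdNormIntervalDeriv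
    linear_combination -aU * hmul s
  have hden : Tendsto
      (fun s => aU * (stdNormPDF (aU * s + b) / stdNormPDF (aL * s + b)) - aL)
      atTop (𝓝 (-aL)) := by
    simpa using (hr.const_mul aU).sub_const aL
  have hden0 := hden.eventually_ne (neg_ne_zero.2 haL.ne')
  have hne : ∀ᶠ s in atTop, stdNormIntervalDeriv aL aU b s ≠ 0 := by
    filter_upwards [hden0] with s hs
    rw [hfac]
    exact mul_ne_zero (stdNormPDF_pos _).ne' hs
  have hinv : Tendsto (fun s : ℝ => s⁻¹) atTop (𝓝 0) := tendsto_inv_atTop_zero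
  refine HasDerivAt.lhopital_zero_atTop
    (f' := fun s => ((aL ^ 2 * (aL * s + b) * stdNormPDF (aL * s + b) -
        aU ^ 2 * (aU * s + b) * stdNormPDF (aU * s + b)) * s -
        stdNormIntervalDeriv aL aU b s * 1) / s ^ 2) ?_
    (Eventually.of_forall (hasDerivAt_stdNormInterval aL aU b)) hne ?_
    (tendsto_stdNormInterval haL haU b) ?_
  · filter_upwards [eventually_ne_atTop 0] with s hs
    exact (hasDerivAt_stdNormIntervalDeriv aL aU b s).div (hasDerivAt_id s) hs
  · simpa [div_eq_mul_inv] using (tendsto_stdNormIntervalDeriv haL haU b).mul hinv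
  · have hlin : ∀ a : ℝ, Tendsto (fun s : ℝ => a ^ 2 * (a + b * s⁻¹)) atTop (𝓝 (a ^ 2 * a)) := by
      intro a
      simpa using ((hinv.const_mul b).const_add a).const_mul (a ^ 2)
    have hmain := (((hlin aL).sub ((hlin aU).mul hr)).div hden (neg_ne_zero.2 haL.ne')).sub
      (hinv.pow 2)
    have hlim : (aL ^ 2 * aL - aU ^ 2 * aU * 0) / -aL - 0 ^ 2 = -aL ^ 2 := by
      field_simp
      ring
    rw [hlim] at hmain
    refine hmain.congr' ?_
    filter_upwards [eventually_ne_atTop 0, hden0] with s hs hs'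
    have hp := (stdNormPDF_pos (aL * s + b)).ne'
    have hsplit := (hmul s).symm
    rw [hfac]
    simp only [Pi.div_apply]
    generalize stdNormPDF (aU * s + b) / stdNormPDF (aL * s + b) = r at hs' hsplit ⊢
    rw [hsplit]
    field_simp

lemma hasDerivAt_logit_stdNormInterval_sqrt {aL aU : ℝ} (haLU : aL < aU) (b : ℝ) {t : ℝ}
    (ht : 0 < t) :
    HasDerivAt (fun t => logit (stdNormInterval aL aU b (Real.sqrt t)))
      (stdNormIntervalDeriv aL aU b (Real.sqrt t) / Real.sqrt t /
        stdNormInterval aL aU b (Real.sqrt t) /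
        (1 - stdNormInterval aL aU b (Real.sqrt t)) / 2) t := by
  have hs : 0 < Real.sqrt t := Real.sqrt_pos.2 ht
  have hmem : stdNormInterval aL aU b (Real.sqrt t) ∈ Set.Ioo (0 : ℝ) 1 :=
    stdNormCDF_sub_mem_Ioo (by gcongr)
  have h0 := hmem.1.ne'
  have h1 := (sub_pos.2 hmem.2).ne'
  refine ((hasDerivAt_logit hmem).comp t ((hasDerivAt_stdNormInterval aL aU b _).comp t
    (Real.hasDerivAt_sqrt ht.ne'))).congr_deriv ?_
  field_simp

/-- For 0 < a_L < a_U and b real, f(t) = Φ(a_U√t + b) − Φ(a_L√t + b) lies in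
(0,1) for all t > 0, g(t) = logit(f(t)) is differentiable for sufficiently
large t, and lim_{t→∞} g′(t) = −a_L²/2 = −min{a_U², a_L²}/2. -/
theorem stmt9 (aL aU b : ℝ) (haL : 0 < aL) (haLU : aL < aU) :
    (∀ t : ℝ, 0 < t →
        stdNormCDF (aU * Real.sqrt t + b) - stdNormCDF (aL * Real.sqrt t + b) ∈
          Set.Ioo (0 : ℝ) 1) ∧
      (∀ᶠ t : ℝ in atTop,
        DifferentiableAt ℝ
          (fun t : ℝ =>
            logit (stdNormCDF (aU * Real.sqrt t + b) - stdNormCDF (aL * Real.sqrt t + b))) t) ∧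
      Tendsto
        (deriv fun t : ℝ =>
          logit (stdNormCDF (aU * Real.sqrt t + b) - stdNormCDF (aL * Real.sqrt t + b)))
        atTop (nhds (-aL ^ 2 / 2)) ∧
      -aL ^ 2 / 2 = -min (aU ^ 2) (aL ^ 2) / 2 := by
  refine ⟨fun t ht => ?_, ?_, ?_, ?_⟩
  · have := Real.sqrt_pos.2 ht
    exact stdNormCDF_sub_mem_Ioo (by gcongr)
  · filter_upwards [eventually_gt_atTop 0] with t ht
    exact (hasDerivAt_logit_stdNormInterval_sqrt haLU b ht).differentiableAt
  · have hlim := (((tendsto_stdNormIntervalDeriv_div haL haLU b).div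
      ((tendsto_stdNormInterval haL (haL.trans haLU) b).const_sub 1)
      (by norm_num)).div_const 2).comp Real.tendsto_sqrt_atTop
    rw [sub_zero, div_one] at hlim
    refine hlim.congr' ?_
    filter_upwards [eventually_gt_atTop 0] with t ht
    exact (hasDerivAt_logit_stdNormInterval_sqrt haLU b ht).deriv.symm
  · rw [min_eq_right (by gcongr)]
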